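/- arXiv:1103.6114 — 5 statements merged into one kernel-verified Lean document; each statement's English description precedes it below -/
import Mathlib

section
/- Let n ≥ 1 and let γ_1, …, γ_n be nonnegative integers. Under the shift process, the probability that all shifted segments are pairwise disjoint equals Pr[A(γ)] = (2^{-(C(n+1,2) - 1)} / ∏_{i=1}^{n-1} (1 - 2^{-(n+1-i)})) · Σ_{σ ∈ Sym_n} ∏_{i=1}^{n-1} 2^{-(n-i)·γ_{σ(i)}}, where C(n+1,2) = binom(n+1, 2) and Sym_n is the set of all permutations of {1, …, n}. -/
open scoped Classical

/-- The event, for the shift process, that the shifted closed integer segments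
`[s i, s i + γ i]` are pairwise disjoint. -/
def shiftDisjoint {n : ℕ} (γ s : Fin n → ℕ) : Prop :=
  ∀ i j : Fin n, i ≠ j →
    Disjoint (Finset.Icc (s i) (s i + γ i)) (Finset.Icc (s j) (s j + γ j))

/-- `prA γ` is the probability, under i.i.d. geometric(1/2) shifts
(`Pr[sᵢ = k] = 2^{-(k+1)}`), that all shifted segments `[sᵢ, sᵢ + γᵢ]`
are pairwise disjoint. -/
noncomputable def prA {n : ℕ} (γ : Fin n → ℕ) : ℝ :=
  ∑' s : Fin n → ℕ,
    if shiftDisjoint γ s then ∏ i : Fin n, ((2:ℝ)⁻¹) ^ (s i + 1) else 0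

/-- The segments `[s i, s i + γ i]` lie in `[m, ∞)`, each one strictly to the right of all
the previous ones. -/
def IsShiftChain {n : ℕ} (m : ℕ) (γ s : Fin n → ℕ) : Prop :=
  (∀ i, m ≤ s i) ∧ ∀ i j, i < j → s i + γ i < s j

theorem isShiftChain_cons {n : ℕ} (m a : ℕ) (γ : Fin (n + 1) → ℕ) (s : Fin n → ℕ) :
    IsShiftChain m γ (Fin.cons a s) ↔ m ≤ a ∧ IsShiftChain (a + γ 0 + 1) (Fin.tail γ) s := by
  simp only [IsShiftChain, Fin.forall_fin_succ, Fin.cons_zero, Fin.cons_succ, Fin.tail,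
    Fin.succ_lt_succ_iff, Fin.succ_pos, Fin.not_lt_zero, false_imp_iff,
    true_and, Nat.succ_le_iff, forall_const]
  constructor
  · rintro ⟨⟨h1, -⟩, h2, h3⟩
    exact ⟨h1, fun i => by have := h2 i; omega, h3⟩
  · rintro ⟨h1, h2, h3⟩
    exact ⟨⟨h1, fun i => by have := h2 i; omega⟩, fun i => by have := h2 i; omega, h3⟩

theorem IsShiftChain.strictMono {n m : ℕ} {γ s : Fin n → ℕ} (h : IsShiftChain m γ s) :
    StrictMono s := fun i j hij => by
  have := h.2 i j hij
  omega

theorem HasSum.prod_of_nonneg {α β : Type*} {f : α × β → ℝ} {g : α → ℝ} {c : ℝ}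
    (hf : ∀ p, 0 ≤ f p) (hfg : ∀ a, HasSum (fun b => f (a, b)) (g a)) (hg : HasSum g c) :
    HasSum f c := by
  have hs : Summable f := by
    refine (summable_prod_of_nonneg hf).2 ⟨fun a => (hfg a).summable, ?_⟩
    simpa only [(hfg _).tsum_eq] using hg.summable
  have := hs.hasSum.prod_fiberwise hfg
  rw [← this.unique hg]
  exact hs.hasSum

theorem hasSum_mul_geometric_ge {r : ℝ} (h0 : 0 ≤ r) (h1 : r < 1) (c : ℝ) (m : ℕ) :
    HasSum (fun a => if m ≤ a then c * r ^ a else 0) (c * (r ^ m / (1 - r))) := by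
  have hinj : Function.Injective (fun k => m + k) := add_right_injective m
  refine (hinj.hasSum_iff (fun a ha => ?_)).1 ?_
  · rw [if_neg]
    exact fun h => ha ⟨a - m, by simp only; omega⟩
  · simpa [Function.comp_def, pow_add, div_eq_mul_inv, mul_assoc] using
      (hasSum_geometric_of_lt_one h0 h1).mul_left (c * r ^ m)

theorem hasSum_isShiftChain {r : ℝ} (h0 : 0 ≤ r) (h1 : r < 1) (n : ℕ) :
    ∀ (m : ℕ) (γ : Fin n → ℕ),
      HasSum (fun s : Fin n → ℕ => if IsShiftChain m γ s then ∏ i, r ^ (s i + 1) else 0)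
        (r ^ (m * n) * (r ^ (n + 1).choose 2 / (∏ j ∈ Finset.Icc 1 n, (1 - r ^ j)) *
          ∏ i : Fin n, r ^ ((n - 1 - (i : ℕ)) * γ i))) := by
  induction n with
  | zero =>
    intro m γ
    simp [IsShiftChain]
  | succ n ih =>
    intro m γ
    rw [← (Fin.consEquiv fun _ : Fin (n + 1) => ℕ).hasSum_iff]
    have hcons : ∀ a (s : Fin n → ℕ),
        Fin.consEquiv (fun _ : Fin (n + 1) => ℕ) (a, s) = Fin.cons a s := fun _ _ => rfl
    have hr : r ^ (n + 1) < 1 := pow_lt_one₀ h0 h1 n.succ_ne_zero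
    refine HasSum.prod_of_nonneg (g := fun a => if m ≤ a then r ^ (a + 1) *
      (r ^ ((a + γ 0 + 1) * n) * (r ^ (n + 1).choose 2 / (∏ j ∈ Finset.Icc 1 n, (1 - r ^ j)) *
          ∏ i : Fin n, r ^ ((n - 1 - (i : ℕ)) * Fin.tail γ i))) else 0) (fun p => ?_)
      (fun a => ?_) ?_
    · simp only [Function.comp_apply]
      split_ifs
      · positivity
      · exact le_rfl
    · simp only [Function.comp_apply, hcons, isShiftChain_cons, Fin.prod_univ_succ,
        Fin.cons_zero, Fin.cons_succ]
      by_cases h : m ≤ a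
      · simpa [h, mul_ite] using (ih (a + γ 0 + 1) (Fin.tail γ)).mul_left (r ^ (a + 1))
      · simp [h]
    · convert hasSum_mul_geometric_ge (pow_nonneg h0 (n + 1)) hr
        (r ^ (1 + (γ 0 + 1) * n) * (r ^ (n + 1).choose 2 / (∏ j ∈ Finset.Icc 1 n, (1 - r ^ j)) *
          ∏ i : Fin n, r ^ ((n - 1 - (i : ℕ)) * Fin.tail γ i))) m using 1
      · funext a
        congr 1
        ring
      · have hch : (n + 1 + 1).choose 2 = n + 1 + (n + 1).choose 2 := by
          rw [Nat.choose_succ_succ' (n + 1) 1, Nat.choose_one_right]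
        have hsub : ∀ i : Fin n, n - (i.succ : ℕ) = n - 1 - (i : ℕ) := fun i => by
          rw [Fin.val_succ]; omega
        rw [Fin.prod_univ_succ, Finset.prod_Icc_succ_top (by omega), hch]
        simp only [hsub, Fin.tail, Fin.val_zero, Nat.add_sub_cancel, Nat.sub_zero, div_eq_mul_inv,
          mul_inv]
        ring

theorem IsShiftChain.shiftDisjoint {n : ℕ} {γ s : Fin n → ℕ} {σ : Equiv.Perm (Fin n)}
    (h : IsShiftChain 0 (γ ∘ σ) (s ∘ σ)) : shiftDisjoint γ s := by
  intro i j hij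
  obtain ⟨i, rfl⟩ := σ.surjective i
  obtain ⟨j, rfl⟩ := σ.surjective j
  rw [Finset.disjoint_left]
  intro x hx hy
  rw [Finset.mem_Icc] at hx hy
  rcases lt_or_gt_of_ne (fun e => hij (congrArg σ e)) with hlt | hlt
  · have := h.2 i j hlt
    simp only [Function.comp_apply] at this
    omega
  · have := h.2 j i hlt
    simp only [Function.comp_apply] at this
    omega

theorem shiftDisjoint.isShiftChain_sort {n : ℕ} {γ s : Fin n → ℕ} (h : shiftDisjoint γ s) :
    IsShiftChain 0 (γ ∘ Tuple.sort s) (s ∘ Tuple.sort s) := by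
  refine ⟨fun _ => Nat.zero_le _, fun i j hij => ?_⟩
  have hle := Tuple.monotone_sort s hij.le
  have hd := h _ _ ((Tuple.sort s).injective.ne hij.ne)
  simp only [Function.comp_apply] at hle ⊢
  by_contra! hcon
  exact Finset.disjoint_left.1 hd (Finset.mem_Icc.2 ⟨hle, hcon⟩)
    (Finset.mem_Icc.2 ⟨le_rfl, Nat.le_add_right _ _⟩)

theorem IsShiftChain.perm_unique {n : ℕ} {γ s : Fin n → ℕ} {σ τ : Equiv.Perm (Fin n)}
    (hσ : IsShiftChain 0 (γ ∘ σ) (s ∘ σ)) (hτ : IsShiftChain 0 (γ ∘ τ) (s ∘ τ)) : σ = τ := by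
  have he := Tuple.unique_monotone hσ.strictMono.monotone hτ.strictMono.monotone
  have hs : Function.Injective s := by
    have := hσ.strictMono.injective.comp σ.symm.injective
    simpa [Function.comp_assoc] using this
  exact Equiv.ext fun i => hs (congrFun he i)

theorem ite_shiftDisjoint_eq_sum_perm {n : ℕ} (γ s : Fin n → ℕ) (w : ℝ) :
    (if shiftDisjoint γ s then w else 0) =
      ∑ σ : Equiv.Perm (Fin n), if IsShiftChain 0 (γ ∘ σ) (s ∘ σ) then w else 0 := by
  by_cases h : shiftDisjoint γ s
  · rw [if_pos h, Finset.sum_eq_single (Tuple.sort s), if_pos h.isShiftChain_sort]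
    · exact fun σ _ hσ => if_neg fun hc => hσ (hc.perm_unique h.isShiftChain_sort)
    · simp
  · rw [if_neg h, Finset.sum_eq_zero fun σ _ => if_neg fun hc => h hc.shiftDisjoint]

/-- Theorem (shift process): for `n ≥ 1` segments of lengths `γ`,
`Pr[A(γ)] = (2^{-(C(n+1,2)-1)} / ∏_{i=1}^{n-1} (1 - 2^{-(n+1-i)}))
  · Σ_{σ ∈ Sym_n} ∏_{i=1}^{n-1} 2^{-(n-i)·γ_{σ(i)}}`.
(Here the product `∏_{i=1}^{n-1} (1 - 2^{-(n+1-i)})` is written via the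
substitution `j = n+1-i` as `∏_{j=2}^{n} (1 - 2^{-j})`, and the inner
product over `i = 1, …, n-1` is written 0-based over all of `Fin n`,
the extra factor being `2^{0·γ_{σ(n-1)}} = 1`.) -/
theorem shift_process_disjoint_prob {n : ℕ} (hn : 1 ≤ n) (γ : Fin n → ℕ) :
    prA γ =
      ((2:ℝ)⁻¹ ^ (Nat.choose (n + 1) 2 - 1) /
          ∏ j ∈ Finset.Icc 2 n, (1 - (2:ℝ)⁻¹ ^ j)) *
        ∑ σ : Equiv.Perm (Fin n),
          ∏ i : Fin n, ((2:ℝ)⁻¹) ^ ((n - 1 - (i : ℕ)) * γ (σ i)) := by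
  have hsum := hasSum_sum (s := Finset.univ) fun (σ : Equiv.Perm (Fin n)) _ =>
    (σ.arrowCongr (Equiv.refl ℕ)).symm.hasSum_iff.2
      (hasSum_isShiftChain (r := (2:ℝ)⁻¹) (by norm_num) (by norm_num) n 0 (γ ∘ σ))
  have hperm : ∀ (σ : Equiv.Perm (Fin n)) (s : Fin n → ℕ),
      ∏ i, (2:ℝ)⁻¹ ^ (s (σ i) + 1) = ∏ i, (2:ℝ)⁻¹ ^ (s i + 1) := fun σ s =>
    Equiv.prod_comp σ fun i => (2:ℝ)⁻¹ ^ (s i + 1)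
  have hcomp : ∀ (σ : Equiv.Perm (Fin n)) (s : Fin n → ℕ),
      (σ.arrowCongr (Equiv.refl ℕ)).symm s = s ∘ σ := fun _ _ => rfl
  simp only [Function.comp_apply, hcomp, hperm, ← ite_shiftDisjoint_eq_sum_perm] at hsum
  rw [prA, hsum.tsum_eq, ← Finset.mul_sum, ← Finset.mul_sum, zero_mul, pow_zero, one_mul]
  congr 1
  have hch : (n + 1).choose 2 = (n + 1).choose 2 - 1 + 1 :=
    (Nat.sub_add_cancel (Nat.choose_pos (by omega))).symm
  rw [← Finset.mul_prod_Ioc_eq_prod_Icc hn, hch, pow_succ, Nat.add_sub_cancel, pow_one,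
    ← Finset.Icc_succ_left_eq_Ioc, mul_comm, show (1:ℝ) - 2⁻¹ = 2⁻¹ by norm_num,
    mul_div_mul_left _ _ (by norm_num)]
  rfl
end

section
/- Let n ≥ 2 and let γ_1, …, γ_n be nonnegative integers. Then Pr[A(γ)] = c(n) · 2^{-C(n+1,2)} · Σ_{σ ∈ Sym_n} ∏_{i=1}^{n-1} 2^{-(n-i)·γ_{σ(i)}}, where c(n) := 2 / ∏_{i=1}^{n-1} (1 - 2^{-(n+1-i)}) satisfies 2 ≤ c(n) ≤ 4; moreover c(2) = 8/3 exactly. -/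
open scoped Classical

/-- The constant `c(n) = 2 / ∏_{i=1}^{n-1} (1 - 2^{-(n+1-i)})`
(written via `j = n+1-i` as `2 / ∏_{j=2}^{n} (1 - 2^{-j})`). -/
noncomputable def cshift (n : ℕ) : ℝ :=
  2 / ∏ j ∈ Finset.Icc 2 n, (1 - (2:ℝ)⁻¹ ^ j)

open Finset in
/-- The positions obtained by placing segments of lengths `g 0, g 1, …` from left to right, where
`t i` is the number of free integers immediately before the `i`-th segment. -/
def positionOfGaps {n : ℕ} (g t : Fin n → ℕ) (i : Fin n) : ℕ :=
  ∑ k ∈ Iic i, t k + ∑ k ∈ Iio i, (g k + 1)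

open Finset in
theorem positionOfGaps_add_lt {n : ℕ} (g t : Fin n → ℕ) {i j : Fin n} (h : i < j) :
    positionOfGaps g t i + g i < positionOfGaps g t j := by
  have h₁ : ∑ k ∈ Iic i, t k ≤ ∑ k ∈ Iic j, t k :=
    sum_le_sum_of_subset (Iic_subset_Iic.2 h.le)
  have h₂ : ∑ k ∈ Iic i, (g k + 1) ≤ ∑ k ∈ Iio j, (g k + 1) :=
    sum_le_sum_of_subset fun k hk => mem_Iio.2 ((mem_Iic.1 hk).trans_lt h)
  rw [← Iio_insert i, sum_insert (by simp)] at h₂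
  unfold positionOfGaps
  omega

theorem positionOfGaps_strictMono {n : ℕ} (g t : Fin n → ℕ) :
    StrictMono (positionOfGaps g t) :=
  fun _ _ h => (Nat.le_add_right _ _).trans_lt (positionOfGaps_add_lt g t h)

open Finset in
theorem positionOfGaps_injective {n : ℕ} (g : Fin n → ℕ) :
    Function.Injective (positionOfGaps g) := by
  intro t t' h
  ext i
  induction i using WellFoundedLT.induction with
  | ind i ih =>
    have hi := congrFun h i
    have hs : ∑ k ∈ Iio i, t k = ∑ k ∈ Iio i, t' k :=
      sum_congr rfl fun k hk => ih k (mem_Iio.1 hk)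
    simp only [positionOfGaps, ← Iio_insert i] at hi
    rw [sum_insert (by simp), sum_insert (by simp)] at hi
    omega

open Finset in
theorem exists_positionOfGaps_eq {n : ℕ} {g p : Fin n → ℕ}
    (h : ∀ i j, i < j → p i + g i < p j) : ∃ t, positionOfGaps g t = p := by
  refine ⟨fun i => p i - (Iio i).sup fun k => p k + g k + 1, ?_⟩
  cases n with
  | zero => exact Subsingleton.elim _ _
  | succ n =>
    funext i
    induction i using Fin.induction with
    | zero =>
      have h₀ : Iio (0 : Fin (n + 1)) = ∅ := by ext; simp
      rw [positionOfGaps, ← Iio_insert, h₀]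
      simp [h₀]
    | succ i ih =>
      have hI : Iio i.succ = Iic i.castSucc := by
        ext k
        simp [Fin.lt_def, Fin.le_def]
      have hsup : ((Iio i.succ).sup fun k => p k + g k + 1) =
          p i.castSucc + g i.castSucc + 1 := by
        rw [hI]
        refine le_antisymm (Finset.sup_le fun k hk => ?_)
          (le_sup (f := fun k => p k + g k + 1) (mem_Iic.2 le_rfl))
        rcases (mem_Iic.1 hk).eq_or_lt with rfl | hk
        · exact le_rfl
        · have := h _ _ hk
          omega
      have hlt := h i.castSucc i.succ Fin.castSucc_lt_succ
      rw [positionOfGaps] at ih ⊢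
      rw [← Iio_insert i.succ, sum_insert (by simp), hsup, hI]
      rw [← Iio_insert i.castSucc, sum_insert (by simp)] at ih ⊢
      rw [sum_insert (by simp)]
      omega

theorem sum_positionOfGaps {n : ℕ} (g t : Fin n → ℕ) :
    ∑ i, positionOfGaps g t i =
      ∑ k : Fin n, (n - (k : ℕ)) * t k + ∑ k : Fin n, (n - 1 - (k : ℕ)) * (g k + 1) := by
  simp only [positionOfGaps]
  rw [Finset.sum_add_distrib]
  congr 1
  · rw [Finset.sum_comm' (t' := Finset.univ) (s' := fun k => Finset.Ici k) (by simp)]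
    simp
  · rw [Finset.sum_comm' (t' := Finset.univ) (s' := fun k => Finset.Ioi k) (by simp)]
    simp

theorem sum_fin_rev_add (n : ℕ) :
    ∑ k : Fin n, (n - 1 - (k : ℕ)) + n = Nat.choose (n + 1) 2 := by
  rw [Fin.sum_univ_eq_sum_range (fun k => n - 1 - k) n, Finset.sum_range_reflect (fun k => k),
    ← Finset.sum_range_succ, Finset.sum_range_id, Nat.choose_two_right]

/-- The shifts for which the segments appear in the order `σ` with gaps `t`. -/
def shiftOfGaps {n : ℕ} (γ : Fin n → ℕ) (x : Equiv.Perm (Fin n) × (Fin n → ℕ)) : Fin n → ℕ :=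
  positionOfGaps (γ ∘ x.1) x.2 ∘ x.1.symm

theorem shiftOfGaps_comp {n : ℕ} (γ : Fin n → ℕ) (x : Equiv.Perm (Fin n) × (Fin n → ℕ)) :
    shiftOfGaps γ x ∘ x.1 = positionOfGaps (γ ∘ x.1) x.2 := by
  ext i
  simp [shiftOfGaps]

theorem shiftOfGaps_injective {n : ℕ} (γ : Fin n → ℕ) :
    Function.Injective (shiftOfGaps γ) := by
  rintro ⟨σ, t⟩ ⟨σ', t'⟩ h
  have h₁ := shiftOfGaps_comp γ (σ, t)
  have h₂ := shiftOfGaps_comp γ (σ', t')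
  rw [← h] at h₂
  have hinj : Function.Injective (shiftOfGaps γ (σ, t)) :=
    (positionOfGaps_strictMono _ _).injective.comp σ.symm.injective
  have hm₁ := positionOfGaps_strictMono (γ ∘ σ) t
  have hm₂ := positionOfGaps_strictMono (γ ∘ σ') t'
  simp only at h₁ h₂
  have hσ : σ = σ' := by
    rw [← h₁] at hm₁
    rw [← h₂] at hm₂
    have hr := (hm₁.range_inj hm₂).1 (by simp [Set.range_comp])
    ext i : 1
    exact hinj (congrFun hr i)
  subst hσ
  rw [positionOfGaps_injective _ (h₁.symm.trans h₂)]

theorem Nat.disjoint_Icc_add_iff (a b c d : ℕ) :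
    Disjoint (Finset.Icc a (a + b)) (Finset.Icc c (c + d)) ↔ a + b < c ∨ c + d < a := by
  rw [Finset.disjoint_left]
  simp only [Finset.mem_Icc]
  constructor
  · intro h
    have := @h (max a c)
    omega
  · intro h x
    omega

theorem range_shiftOfGaps {n : ℕ} (γ : Fin n → ℕ) :
    Set.range (shiftOfGaps γ) = {s | shiftDisjoint γ s} := by
  ext s
  simp only [Set.mem_range, Set.mem_ofPred_eq, shiftDisjoint, Nat.disjoint_Icc_add_iff]
  constructor
  · rintro ⟨⟨σ, t⟩, rfl⟩ i j hij
    rcases lt_or_gt_of_ne (σ.symm.injective.ne hij) with h | h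
    · left
      simpa [shiftOfGaps] using positionOfGaps_add_lt (γ ∘ σ) t h
    · right
      simpa [shiftOfGaps] using positionOfGaps_add_lt (γ ∘ σ) t h
  · intro h
    have hgap : ∀ i j, i < j →
        (s ∘ Tuple.sort s) i + (γ ∘ Tuple.sort s) i < (s ∘ Tuple.sort s) j := by
      intro i j hij
      have hle := Tuple.monotone_sort s hij.le
      have := h _ _ ((Tuple.sort s).injective.ne hij.ne)
      simp only [Function.comp_apply] at hle ⊢
      omega
    obtain ⟨t, ht⟩ := exists_positionOfGaps_eq hgap
    refine ⟨(Tuple.sort s, t), ?_⟩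
    ext i
    simp [shiftOfGaps, ht]

theorem prod_pow_shiftOfGaps {n : ℕ} (r : ℝ) (γ : Fin n → ℕ)
    (x : Equiv.Perm (Fin n) × (Fin n → ℕ)) :
    ∏ i, r ^ (shiftOfGaps γ x i + 1) =
      (r ^ Nat.choose (n + 1) 2 * ∏ i : Fin n, r ^ ((n - 1 - (i : ℕ)) * γ (x.1 i))) *
        ∏ i : Fin n, (r ^ (n - (i : ℕ))) ^ x.2 i := by
  simp_rw [← pow_mul, Finset.prod_pow_eq_pow_sum, ← pow_add]
  congr 1
  have h : ∑ i, shiftOfGaps γ x i = ∑ i, positionOfGaps (γ ∘ x.1) x.2 i :=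
    Equiv.sum_comp x.1.symm (positionOfGaps (γ ∘ x.1) x.2)
  rw [Finset.sum_add_distrib, h, sum_positionOfGaps, ← sum_fin_rev_add]
  simp only [mul_add, Finset.sum_add_distrib, mul_one, Function.comp_apply, Finset.sum_const,
    Finset.card_univ, Fintype.card_fin, smul_eq_mul]
  ring

theorem hasSum_prod_fin {α : Type*} {n : ℕ} {f : Fin n → α → ℝ} {a : Fin n → ℝ}
    (hf : ∀ i, HasSum (f i) (a i)) (h₀ : ∀ i x, 0 ≤ f i x) :
    HasSum (fun t : Fin n → α => ∏ i, f i (t i)) (∏ i, a i) := by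
  induction n with
  | zero => simp [hasSum_unique]
  | succ n ih =>
    have hg := ih (f := fun i => f i.succ) (fun i => hf i.succ) fun i => h₀ i.succ
    rw [Fin.prod_univ_succ, ← (Fin.consEquiv fun _ : Fin (n + 1) => α).hasSum_iff]
    have h₁ : 0 ≤ fun t : Fin n → α => ∏ i, f i.succ (t i) :=
      fun t => Finset.prod_nonneg fun i _ => h₀ i.succ (t i)
    have hs := (hf 0).summable.mul_of_nonneg hg.summable (h₀ 0) h₁
    refine (congrArg (HasSum · _) (funext fun x => ?_)).mp ((hf 0).mul hg hs)
    simp [Fin.consEquiv, Fin.prod_univ_succ]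

theorem prod_Icc_two_add_half_pow_le (n : ℕ) (hn : 1 ≤ n) :
    (2 : ℝ)⁻¹ + 2⁻¹ ^ n ≤ ∏ j ∈ Finset.Icc 2 n, (1 - (2 : ℝ)⁻¹ ^ j) := by
  induction n, hn using Nat.le_induction with
  | base => norm_num
  | succ n hn ih =>
    rw [Finset.prod_Icc_succ_top (by omega)]
    have h₁ : (2 : ℝ)⁻¹ ^ n ≤ 2⁻¹ := pow_le_of_le_one (by norm_num) (by norm_num) (by omega)
    have h₂ : (0 : ℝ) < 2⁻¹ ^ n := by positivity
    rw [pow_succ]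
    nlinarith

theorem prod_Icc_two_le_one (n : ℕ) :
    ∏ j ∈ Finset.Icc 2 n, (1 - (2 : ℝ)⁻¹ ^ j) ≤ 1 := by
  refine Finset.prod_le_one (fun j _ => ?_) fun j _ => ?_
  · exact sub_nonneg.2 (pow_le_one₀ (by norm_num) (by norm_num))
  · exact sub_le_self _ (by positivity)

theorem prod_inv_one_sub_eq_cshift {n : ℕ} (hn : 1 ≤ n) :
    ∏ i : Fin n, (1 - (2 : ℝ)⁻¹ ^ (n - (i : ℕ)))⁻¹ = cshift n := by
  have h : ∏ i : Fin n, (1 - (2 : ℝ)⁻¹ ^ (n - (i : ℕ))) =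
      2⁻¹ * ∏ j ∈ Finset.Icc 2 n, (1 - (2 : ℝ)⁻¹ ^ j) := by
    rw [Fin.prod_univ_eq_prod_range (fun i => 1 - (2 : ℝ)⁻¹ ^ (n - i)) n,
      ← Finset.prod_range_reflect]
    obtain ⟨m, rfl⟩ := Nat.exists_eq_add_of_le' hn
    have h' : ∀ j ∈ Finset.range (m + 1),
        1 - (2 : ℝ)⁻¹ ^ (m + 1 - (m + 1 - 1 - j)) = 1 - 2⁻¹ ^ (j + 1) := by
      intro j hj
      rw [Finset.mem_range] at hj
      congr 2
      omega
    rw [Finset.prod_congr rfl h', Finset.prod_range_succ', mul_comm]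
    congr 1
    · norm_num
    · rw [← Finset.Ico_add_one_right_eq_Icc, Finset.prod_Ico_eq_prod_range]
      refine Finset.prod_congr (by simp) fun j _ => ?_
      congr 2
      omega
  rw [Finset.prod_inv_distrib, h, cshift, mul_inv, inv_inv, div_eq_mul_inv]

theorem prA_eq {n : ℕ} (hn : 1 ≤ n) (γ : Fin n → ℕ) :
    prA γ = cshift n * (2 : ℝ)⁻¹ ^ (Nat.choose (n + 1) 2) *
      ∑ σ : Equiv.Perm (Fin n), ∏ i : Fin n, ((2 : ℝ)⁻¹) ^ ((n - 1 - (i : ℕ)) * γ (σ i)) := by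
  have hgeom : HasSum (fun t : Fin n → ℕ => ∏ i : Fin n, ((2 : ℝ)⁻¹ ^ (n - (i : ℕ))) ^ t i)
      (cshift n) := by
    rw [← prod_inv_one_sub_eq_cshift hn]
    refine hasSum_prod_fin (f := fun i k => ((2 : ℝ)⁻¹ ^ (n - (i : ℕ))) ^ k) (fun i => ?_)
      fun i k => by positivity
    exact hasSum_geometric_of_lt_one (by positivity)
      (pow_lt_one₀ (by norm_num) (by norm_num) (Nat.sub_ne_zero_of_lt i.2))
  have hsum := hasSum_fintype fun σ : Equiv.Perm (Fin n) =>
    (2 : ℝ)⁻¹ ^ Nat.choose (n + 1) 2 *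
      ∏ i : Fin n, (2 : ℝ)⁻¹ ^ ((n - 1 - (i : ℕ)) * γ (σ i))
  have hprod := hsum.summable.mul_of_nonneg hgeom.summable
    (fun σ => by positivity) (fun t => by positivity)
  have hmul := hsum.mul hgeom hprod
  have hsupp : Function.support (fun s : Fin n → ℕ =>
      if shiftDisjoint γ s then ∏ i : Fin n, ((2 : ℝ)⁻¹) ^ (s i + 1) else 0) ⊆
      Set.range (shiftOfGaps γ) := by
    rw [range_shiftOfGaps]
    intro s hs
    by_contra hd
    exact hs (if_neg hd)
  rw [prA, ← (shiftOfGaps_injective γ).tsum_eq hsupp]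
  have hterm : ∀ x, (if shiftDisjoint γ (shiftOfGaps γ x) then
      ∏ i : Fin n, ((2 : ℝ)⁻¹) ^ (shiftOfGaps γ x i + 1) else 0) = _ := fun x =>
    (if_pos (range_shiftOfGaps γ ▸ Set.mem_range_self x :
      shiftOfGaps γ x ∈ {s | shiftDisjoint γ s})).trans (prod_pow_shiftOfGaps _ γ x)
  rw [tsum_congr hterm, hmul.tsum_eq, ← Finset.mul_sum]
  ring

/-- Corollary (shift process): for `n ≥ 2` segments of lengths `γ`,
`Pr[A(γ)] = c(n) · 2^{-C(n+1,2)} · Σ_{σ ∈ Sym_n} ∏_{i=1}^{n-1} 2^{-(n-i)·γ_{σ(i)}}`,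
with `2 ≤ c(n) ≤ 4` and `c(2) = 8/3` exactly.  (The inner product over
`i = 1, …, n-1` is written 0-based over all of `Fin n`, the extra factor
being `2^{0·γ_{σ(n-1)}} = 1`.) -/
theorem shift_process_disjoint_prob_simplified {n : ℕ} (hn : 2 ≤ n) (γ : Fin n → ℕ) :
    (prA γ =
        cshift n * (2:ℝ)⁻¹ ^ (Nat.choose (n + 1) 2) *
          ∑ σ : Equiv.Perm (Fin n),
            ∏ i : Fin n, ((2:ℝ)⁻¹) ^ ((n - 1 - (i : ℕ)) * γ (σ i))) ∧
      2 ≤ cshift n ∧ cshift n ≤ 4 ∧ cshift 2 = 8 / 3 := by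
  have hpos : (2 : ℝ)⁻¹ < ∏ j ∈ Finset.Icc 2 n, (1 - (2 : ℝ)⁻¹ ^ j) :=
    (lt_add_of_pos_right _ (by positivity)).trans_le
      (prod_Icc_two_add_half_pow_le n (by omega))
  have hle := prod_Icc_two_le_one n
  refine ⟨prA_eq (by omega) γ, ?_, ?_, ?_⟩
  · rw [cshift, le_div_iff₀ (by linarith)]
    linarith
  · rw [cshift, div_le_iff₀ (by linarith)]
    linarith
  · norm_num [cshift]
end

section
/- For every integer n ≥ 2, the finite product ∏_{i=2}^{n} (1 - 2^{-i}) satisfies ∏_{i=2}^{n} (1 - 2^{-i}) ≥ e^{-2/3} > 1/2. -/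
theorem exp_neg_four_thirds_mul_le_one_sub {x : ℝ} (h0 : 0 ≤ x) (h1 : x ≤ 1 / 4) :
    Real.exp (-(4 / 3 * x)) ≤ 1 - x := by
  have hx : 0 < 1 - x := by linarith
  have h : (1 - x)⁻¹ ≤ Real.exp (4 / 3 * x) := by
    refine le_trans ?_ (Real.add_one_le_exp _)
    rw [inv_le_iff_one_le_mul₀ hx]
    nlinarith
  rw [Real.exp_neg]
  exact inv_le_of_inv_le₀ hx h

theorem exp_le_prod_one_sub_two_inv_pow {n : ℕ} (hn : 1 ≤ n) :
    Real.exp (-(4 / 3 * (1 / 2 - (2 : ℝ)⁻¹ ^ n))) ≤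
      ∏ i ∈ Finset.Icc 2 n, (1 - (2 : ℝ)⁻¹ ^ i) := by
  induction n, hn using Nat.le_induction with
  | base => norm_num
  | succ k hk ih =>
    rw [Finset.prod_Icc_succ_top (by omega)]
    have hpow : (2 : ℝ)⁻¹ ^ (k + 1) ≤ 1 / 4 :=
      (pow_le_pow_of_le_one (by norm_num) (by norm_num) (by omega : 2 ≤ k + 1)).trans
        (by norm_num)
    have hstep := exp_neg_four_thirds_mul_le_one_sub (by positivity) hpow
    calc Real.exp (-(4 / 3 * (1 / 2 - (2 : ℝ)⁻¹ ^ (k + 1))))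
        = Real.exp (-(4 / 3 * (1 / 2 - (2 : ℝ)⁻¹ ^ k))) *
            Real.exp (-(4 / 3 * (2 : ℝ)⁻¹ ^ (k + 1))) := by
          rw [← Real.exp_add]
          congr 1
          ring
      _ ≤ _ := mul_le_mul ih hstep (Real.exp_pos _).le ((Real.exp_pos _).le.trans ih)

/-- For every integer `n ≥ 2`, the finite product `∏_{i=2}^{n} (1 - 2^{-i})`
satisfies `∏_{i=2}^{n} (1 - 2^{-i}) ≥ e^{-2/3} > 1/2`. -/
theorem prod_one_sub_two_pow_ge (n : ℕ) (hn : 2 ≤ n) :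
    (∏ i ∈ Finset.Icc 2 n, (1 - (2:ℝ)⁻¹ ^ i)) ≥ Real.exp (-(2 / 3)) ∧
      Real.exp (-(2 / 3)) > 1 / 2 := by
  constructor
  · refine le_trans (Real.exp_le_exp.mpr ?_)
      (exp_le_prod_one_sub_two_inv_pow (by omega : 1 ≤ n))
    have : (0 : ℝ) ≤ 2⁻¹ ^ n := by positivity
    linarith
  · rw [gt_iff_lt, ← Real.log_lt_iff_lt_exp (by norm_num), one_div, Real.log_inv]
    linarith [Real.log_two_gt_d9]
end

section
/- Let γ_1, γ_2 be nonnegative integers. For two segments under the shift process, the probability that the two shifted segments are disjoint is Pr[A(γ_1, γ_2)] = (1/3) · (2^{-γ_1} + 2^{-γ_2}). -/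
open scoped Classical

/-- Two segments are disjoint exactly when one ends strictly before the other begins. -/
theorem shiftDisjoint_two_iff (γ₁ γ₂ : ℕ) (s : Fin 2 → ℕ) :
    shiftDisjoint ![γ₁, γ₂] s ↔ s 0 + γ₁ < s 1 ∨ s 1 + γ₂ < s 0 := by
  have key : ∀ a b c d : ℕ,
      Disjoint (Finset.Icc a (a + c)) (Finset.Icc b (b + d)) ↔ a + c < b ∨ b + d < a := by
    intro a b c d
    rw [Finset.disjoint_left]
    constructor
    · intro h
      by_contra hn
      have := @h (max a b)
      simp only [Finset.mem_Icc] at this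
      omega
    · intro h x hx hy
      simp only [Finset.mem_Icc] at hx hy
      omega
  simp only [shiftDisjoint, Fin.forall_fin_two, key]
  simp
  tauto

/-- The probability that the second of two geometric shifts exceeds the first by more than `c`. -/
theorem hasSum_geometric_add_lt (c : ℕ) :
    HasSum (fun p : ℕ × ℕ =>
      if p.1 + c < p.2 then (2:ℝ)⁻¹ ^ (p.1 + 1) * (2:ℝ)⁻¹ ^ (p.2 + 1) else 0)
      (1 / 3 * (2:ℝ)⁻¹ ^ c) := by
  have hinj : Function.Injective (fun q : ℕ × ℕ => (q.1, q.1 + c + 1 + q.2)) := by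
    rintro ⟨a, b⟩ ⟨a', b'⟩ h
    simp only [Prod.mk.injEq] at h ⊢
    omega
  rw [← hinj.hasSum_iff]
  · have h4 : HasSum (fun n : ℕ => (4:ℝ)⁻¹ ^ n) (1 - (4:ℝ)⁻¹)⁻¹ :=
      hasSum_geometric_of_lt_one (by norm_num) (by norm_num)
    have h2 : HasSum (fun n : ℕ => (2:ℝ)⁻¹ ^ n) (1 - (2:ℝ)⁻¹)⁻¹ :=
      hasSum_geometric_of_lt_one (by norm_num) (by norm_num)
    have h := (h4.mul h2 (h4.summable.mul_of_nonneg h2.summable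
      (fun n => by positivity) (fun n => by positivity))).mul_left ((2:ℝ)⁻¹ ^ (c + 3))
    have hval : 1 / 3 * (2:ℝ)⁻¹ ^ c =
        (2:ℝ)⁻¹ ^ (c + 3) * ((1 - (4:ℝ)⁻¹)⁻¹ * (1 - (2:ℝ)⁻¹)⁻¹) := by
      rw [pow_add]
      norm_num
      ring
    rw [hval]
    convert! h using 1
    · funext ⟨a, d⟩
      have hlt : a + c < a + c + 1 + d := by omega
      have h42 : (4:ℝ)⁻¹ = (2:ℝ)⁻¹ ^ 2 := by norm_num
      simp only [Function.comp_apply, hlt, if_true, h42, ← pow_mul]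
      ring
  · rintro ⟨a, b⟩ hab
    rw [if_neg]
    intro hlt
    exact hab ⟨(a, b - (a + c + 1)), by
      simp only [Prod.mk.injEq, true_and] at hlt ⊢
      omega⟩

/-- For two segments of lengths `γ₁, γ₂` under the shift process, the
probability that the two shifted segments are disjoint is
`Pr[A(γ₁, γ₂)] = (1/3) · (2^{-γ₁} + 2^{-γ₂})`. -/
theorem shift_process_two_segments (γ₁ γ₂ : ℕ) :
    prA ![γ₁, γ₂] = (1 / 3) * ((2:ℝ)⁻¹ ^ γ₁ + (2:ℝ)⁻¹ ^ γ₂) := by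
  have h₂ := (Equiv.prodComm ℕ ℕ).hasSum_iff.mpr (hasSum_geometric_add_lt γ₂)
  have h := (finTwoArrowEquiv ℕ).hasSum_iff.mpr ((hasSum_geometric_add_lt γ₁).add h₂)
  rw [mul_add, prA, ← h.tsum_eq]
  refine tsum_congr fun s => ?_
  simp only [shiftDisjoint_two_iff, Fin.prod_univ_two, Function.comp_apply, finTwoArrowEquiv_apply,
    Equiv.prodComm_apply, Prod.fst_swap, Prod.snd_swap]
  by_cases h1 : s 0 + γ₁ < s 1
  · have h2 : ¬ s 1 + γ₂ < s 0 := by omega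
    simp [h1, h2]
  · by_cases h2 : s 1 + γ₂ < s 0
    · simp [h1, h2, mul_comm]
    · simp [h1, h2]
end

section
/- For n ≥ 1 let Q_n = (2^{-(C(n+1,2)-1)} / ∏_{i=1}^{n-1}(1 - 2^{-(n+1-i)})) · n! · 2^{-2·C(n,2)} (the disjointness probability for n segments of length 2 under the shift process). If (p_n)_{n≥1} is any sequence of reals satisfying 2^{-(n-1)} · Q_n ≤ p_n ≤ Q_n for all n, then log₂(p_n) / n² → -3/2 as n → ∞; equivalently p_n = 2^{-n²(3/2 + o(1))}. (In particular, the probability of successful execution of n buggy threads is asymptotically identical in all memory models, since in every memory model each thread's critical window stays at its minimum length 2 with probability at least 1/2, giving the sandwich bounds.) -/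
/-- `Q n` is the disjointness probability for `n` segments of length 2 under
the shift process:
`Q_n = (2^{-(C(n+1,2)-1)} / ∏_{i=1}^{n-1}(1 - 2^{-(n+1-i)})) · n! · 2^{-2·C(n,2)}`
(the product is written via `j = n+1-i` as `∏_{j=2}^{n} (1 - 2^{-j})`). -/
noncomputable def Qseq (n : ℕ) : ℝ :=
  ((2:ℝ)⁻¹ ^ (Nat.choose (n + 1) 2 - 1) /
      ∏ j ∈ Finset.Icc 2 n, (1 - (2:ℝ)⁻¹ ^ j)) *
    (Nat.factorial n) * (2:ℝ)⁻¹ ^ (2 * Nat.choose n 2)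

open Real in
lemma logb_two_factorial_mem_Icc (n : ℕ) :
    logb 2 (n.factorial : ℝ) ∈ Set.Icc 0 (n * logb 2 n) := by
  have hpos : (0 : ℝ) < n.factorial := by exact_mod_cast n.factorial_pos
  constructor
  · exact logb_nonneg one_lt_two (by exact_mod_cast n.factorial_pos)
  · rw [← logb_pow]
    exact logb_le_logb_of_le one_lt_two hpos (by exact_mod_cast n.factorial_le_pow)

lemma prod_one_sub_inv_two_pow_mem_Icc (n : ℕ) :
    ∏ j ∈ Finset.Icc 2 n, (1 - (2 : ℝ)⁻¹ ^ j) ∈ Set.Icc ((2 : ℝ)⁻¹ ^ n) 1 := by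
  have hfac : ∀ j ∈ Finset.Icc 2 n, (2 : ℝ)⁻¹ ≤ 1 - (2 : ℝ)⁻¹ ^ j := by
    intro j hj
    have h : (2 : ℝ)⁻¹ ^ j ≤ (2 : ℝ)⁻¹ ^ 1 :=
      pow_le_pow_of_le_one (by norm_num) (by norm_num)
        (one_le_two.trans (Finset.mem_Icc.mp hj).1)
    norm_num at h ⊢
    linarith
  constructor
  · calc (2 : ℝ)⁻¹ ^ n ≤ (2 : ℝ)⁻¹ ^ (Finset.Icc 2 n).card :=
          pow_le_pow_of_le_one (by norm_num) (by norm_num) (by rw [Nat.card_Icc]; omega)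
      _ = ∏ _j ∈ Finset.Icc 2 n, (2 : ℝ)⁻¹ := by rw [Finset.prod_const]
      _ ≤ _ := Finset.prod_le_prod (fun _ _ => by norm_num) hfac
  · refine Finset.prod_le_one (fun j hj => le_trans (by norm_num) (hfac j hj)) fun j _ => ?_
    have : (0 : ℝ) ≤ (2 : ℝ)⁻¹ ^ j := by positivity
    linarith

open Real in
lemma logb_two_inv_two_pow (k : ℕ) : logb 2 ((2 : ℝ)⁻¹ ^ k) = -k := by
  rw [logb_pow, logb_inv, logb_self_eq_one one_lt_two, mul_neg_one]

lemma Qseq_pos (n : ℕ) : 0 < Qseq n := by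
  have hP : (0 : ℝ) < ∏ j ∈ Finset.Icc 2 n, (1 - (2 : ℝ)⁻¹ ^ j) :=
    lt_of_lt_of_le (by positivity) (prod_one_sub_inv_two_pow_mem_Icc n).1
  have := n.factorial_pos
  unfold Qseq
  positivity

open Real in
lemma logb_two_Qseq {n : ℕ} (hn : 1 ≤ n) :
    logb 2 (Qseq n) = -(3 / 2) * (n : ℝ) ^ 2 + n / 2 + 1
      - logb 2 (∏ j ∈ Finset.Icc 2 n, (1 - (2 : ℝ)⁻¹ ^ j)) + logb 2 n.factorial := by
  have hP : ∏ j ∈ Finset.Icc 2 n, (1 - (2 : ℝ)⁻¹ ^ j) ≠ 0 :=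
    (lt_of_lt_of_le (by positivity) (prod_one_sub_inv_two_pow_mem_Icc n).1).ne'
  have hf : (n.factorial : ℝ) ≠ 0 := by exact_mod_cast n.factorial_ne_zero
  have hpow : ∀ k : ℕ, (2 : ℝ)⁻¹ ^ k ≠ 0 := fun k => by positivity
  have hc : 1 ≤ (n + 1).choose 2 := Nat.choose_pos (by omega)
  unfold Qseq
  rw [logb_mul (mul_ne_zero (div_ne_zero (hpow _) hP) hf) (hpow _),
    logb_mul (div_ne_zero (hpow _) hP) hf, logb_div (hpow _) hP,
    logb_two_inv_two_pow, logb_two_inv_two_pow, Nat.cast_sub hc]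
  push_cast [Nat.cast_choose_two]
  ring

open Real in
lemma logb_two_Qseq_mem_Icc {n : ℕ} (hn : 1 ≤ n) :
    logb 2 (Qseq n) ∈
      Set.Icc (-(3 / 2) * (n : ℝ) ^ 2) (-(3 / 2) * (n : ℝ) ^ 2 + 3 * n + n * logb 2 n) := by
  obtain ⟨hP₁, hP₂⟩ := prod_one_sub_inv_two_pow_mem_Icc n
  obtain ⟨hf₁, hf₂⟩ := logb_two_factorial_mem_Icc n
  have hlow := logb_le_logb_of_le one_lt_two (by positivity) hP₁
  have hup := logb_nonpos one_lt_two (le_trans (by positivity) hP₁) hP₂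
  rw [logb_two_inv_two_pow] at hlow
  have hn' : (1 : ℝ) ≤ n := by exact_mod_cast hn
  rw [logb_two_Qseq hn]
  constructor <;> linarith

open Real Filter in
lemma tendsto_logb_two_natCast_div_natCast :
    Tendsto (fun n : ℕ => logb 2 (n : ℝ) / n) atTop (nhds 0) := by
  have h := (isLittleO_log_id_atTop.tendsto_div_nhds_zero.comp
    tendsto_natCast_atTop_atTop).div_const (log 2)
  rw [zero_div] at h
  refine h.congr fun n => ?_
  simp only [Function.comp_apply, id_eq, logb]
  ring

/-- If `(p_n)_{n≥1}` is any sequence of reals with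
`2^{-(n-1)}·Q_n ≤ p_n ≤ Q_n` for all `n ≥ 1`, then `log₂(p_n) / n² → -3/2`
as `n → ∞`; equivalently `p_n = 2^{-n²(3/2 + o(1))}`.  (So the probability of
successful execution of `n` buggy threads is asymptotically identical in all
memory models.) -/
theorem all_models_asymptotics (p : ℕ → ℝ)
    (hp : ∀ n : ℕ, 1 ≤ n → (2:ℝ)⁻¹ ^ (n - 1) * Qseq n ≤ p n ∧ p n ≤ Qseq n) :
    Filter.Tendsto (fun n : ℕ => Real.logb 2 (p n) / (n : ℝ) ^ 2)
      Filter.atTop (nhds (-(3 / 2))) := by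
  have hinv (c : ℝ) : Filter.Tendsto (fun n : ℕ => c / (n : ℝ)) Filter.atTop (nhds 0) :=
    tendsto_const_div_atTop_nhds_zero_nat c
  have hlow : Filter.Tendsto (fun n : ℕ => -(3 / 2 : ℝ) - 1 / n) Filter.atTop
      (nhds (-(3 / 2))) := by
    simpa using (hinv 1).const_sub (-(3 / 2 : ℝ))
  have hup : Filter.Tendsto (fun n : ℕ => -(3 / 2 : ℝ) + (3 / n + Real.logb 2 n / n))
      Filter.atTop (nhds (-(3 / 2))) := by
    simpa using ((hinv 3).add tendsto_logb_two_natCast_div_natCast).const_add (-(3 / 2 : ℝ))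
  refine tendsto_of_tendsto_of_tendsto_of_le_of_le' hlow hup ?_ ?_ <;>
    filter_upwards [Filter.eventually_ge_atTop 1] with n hn
  all_goals
    obtain ⟨hp₁, hp₂⟩ := hp n hn
    have hQ := Qseq_pos n
    have hpow : (0 : ℝ) < (2 : ℝ)⁻¹ ^ (n - 1) := by positivity
    obtain ⟨hQ₁, hQ₂⟩ := logb_two_Qseq_mem_Icc hn
    have hn' : (0 : ℝ) < n := by exact_mod_cast hn
  · have h := Real.logb_le_logb_of_le one_lt_two (mul_pos hpow hQ) hp₁
    rw [Real.logb_mul hpow.ne' hQ.ne', logb_two_inv_two_pow, Nat.cast_sub hn,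
      Nat.cast_one] at h
    rw [le_div_iff₀ (by positivity)]
    have : (-(3 / 2 : ℝ) - 1 / n) * (n : ℝ) ^ 2 = -(3 / 2) * (n : ℝ) ^ 2 - n := by
      field_simp
    linarith
  · have h := Real.logb_le_logb_of_le one_lt_two ((mul_pos hpow hQ).trans_le hp₁) hp₂
    rw [div_le_iff₀ (by positivity)]
    have : (-(3 / 2 : ℝ) + (3 / n + Real.logb 2 n / n)) * (n : ℝ) ^ 2
        = -(3 / 2) * (n : ℝ) ^ 2 + 3 * n + n * Real.logb 2 n := by
      field_simp
      ring
    linarith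
end
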